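/- arXiv:2211.10392 — 2 statements merged into one kernel-verified Lean document; each statement's English description precedes it below -/
import Mathlib

section
/- Let φ ∈ 𝒮[0,∞) and define F̃[φ](λ) = ∫₀^∞ φ(y)(α²e^{-iαλy} + αe^{-iα²λy})dy, which is analytic on a neighbourhood of the closed sector arg λ ∈ [π/3, 2π/3]. Then for every x > 0, the contour integral ∫_{∂D⁺} e^{iλx} F̃[φ](λ) dλ = 0. -/
open MeasureTheory Set

noncomputable section

/-- The Schwartz class `𝒮[0,∞)`: smooth functions which, together with all derivatives,
decay faster than any polynomial as `y → ∞`. -/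
def SchwartzHalfLine (φ : ℝ → ℂ) : Prop :=
  ContDiff ℝ (⊤ : ℕ∞) φ ∧ ∀ n k : ℕ, ∃ C : ℝ, ∀ y : ℝ, 0 ≤ y → y ^ n * ‖iteratedDeriv k φ y‖ ≤ C

/-- The primitive cube root of unity `α = e^{2πi/3}`. -/
def alpha : ℂ := Complex.exp (2 * Real.pi * Complex.I / 3)

/-- `F̃[φ](λ) = ∫₀^∞ φ(y) (α² e^{-iαλy} + α e^{-iα²λy}) dy`, the analytic extension of the
`∂D⁺` formula for the Fokas transform. -/
def Ftilde (φ : ℝ → ℂ) (l : ℂ) : ℂ :=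
  ∫ y in Ioi (0 : ℝ),
    φ y * (alpha ^ 2 * Complex.exp (-Complex.I * alpha * l * (y : ℂ))
      + alpha * Complex.exp (-Complex.I * alpha ^ 2 * l * (y : ℂ)))

/-- Contour integral along the ray `arg λ = θ`, traversed from `0` out to `∞`. -/
def rayIntegral (θ : ℝ) (g : ℂ → ℂ) : ℂ :=
  ∫ t in Ioi (0 : ℝ), g ((t : ℂ) * Complex.exp ((θ : ℂ) * Complex.I))
    * Complex.exp ((θ : ℂ) * Complex.I)

/-- Contour integral along `∂D⁺`, the positively oriented boundary of the sector
`arg λ ∈ (π/3, 2π/3)`: the ray `arg λ = 2π/3` from `∞` down to `0` followed by the ray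
`arg λ = π/3` from `0` out to `∞`. -/
def bdDplus (g : ℂ → ℂ) : ℂ :=
  rayIntegral (Real.pi / 3) g - rayIntegral (2 * Real.pi / 3) g

theorem SchwartzHalfLine.integrableOn {φ : ℝ → ℂ} (hφ : SchwartzHalfLine φ) :
    IntegrableOn φ (Ioi 0) := by
  obtain ⟨C₀, h₀⟩ := hφ.2 0 0
  obtain ⟨C₂, h₂⟩ := hφ.2 2 0
  refine Integrable.mono' (g := fun y : ℝ => (C₀ + C₂) * (1 + y ^ 2)⁻¹)
    (integrable_inv_one_add_sq.const_mul _).integrableOn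
    hφ.1.continuous.aestronglyMeasurable ?_
  filter_upwards [ae_restrict_mem measurableSet_Ioi] with y hy
  have a := h₀ y (le_of_lt hy)
  have b := h₂ y (le_of_lt hy)
  simp only [iteratedDeriv_zero, pow_zero, one_mul] at a b
  rw [← div_eq_mul_inv, le_div_iff₀ (by positivity)]
  linarith

theorem norm_cexp_neg_I_mul_le_one {c l : ℂ} (h : (c * l).im ≤ 0) {y : ℝ} (hy : 0 ≤ y) :
    ‖Complex.exp (-Complex.I * c * l * (y : ℂ))‖ ≤ 1 := by
  rw [Complex.norm_exp, Real.exp_le_one_iff]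
  have e : (-Complex.I * c * l * (y : ℂ)).re = (c * l).im * y := by
    rw [Complex.re_mul_ofReal, mul_assoc, neg_mul, Complex.neg_re, Complex.I_mul_re, neg_neg]
  rw [e]
  exact mul_nonpos_of_nonpos_of_nonneg h hy

theorem norm_alpha : ‖alpha‖ = 1 := by
  rw [alpha, Complex.norm_exp]
  simp [mul_div_assoc]

/-- The integral of an exponential along the ray through `w` does not depend on `w`, as long as
the exponential decays along it. -/
theorem integral_ray_cexp {w c : ℂ} {x y : ℝ} (hx : 0 < x) (hy : 0 ≤ y) (hw : 0 < w.im)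
    (hc : (c * w).im ≤ 0) :
    IntegrableOn (fun t : ℝ => Complex.exp (Complex.I * (t * w) * x)
        * Complex.exp (-Complex.I * c * (t * w) * y)) (Ioi 0) ∧
      ∫ t in Ioi (0 : ℝ), Complex.exp (Complex.I * (t * w) * x)
        * Complex.exp (-Complex.I * c * (t * w) * y) * w = Complex.I / (x - c * y) := by
  set a : ℂ := Complex.I * (w * x - c * w * y) with ha
  have e : ∀ t : ℝ, Complex.exp (Complex.I * (t * w) * x)
      * Complex.exp (-Complex.I * c * (t * w) * y) = Complex.exp (a * t) := fun t => by
    rw [← Complex.exp_add, ha]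
    ring_nf
  have hare : a.re < 0 := by
    rw [ha, Complex.I_mul_re, Complex.sub_im, Complex.im_mul_ofReal, Complex.im_mul_ofReal]
    nlinarith [mul_pos hw hx, mul_nonneg (neg_nonneg.2 hc) hy]
  have ha0 : a ≠ 0 := fun h => by simp [h] at hare
  have hw0 : w ≠ 0 := fun h => by simp [h] at hw
  have hfac : a = Complex.I * w * (x - c * y) := by rw [ha]; ring
  have hd : (x - c * y : ℂ) ≠ 0 := fun h => ha0 (by rw [hfac, h, mul_zero])
  simp only [e]
  refine ⟨integrableOn_exp_mul_complex_Ioi hare 0, ?_⟩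
  rw [integral_mul_const, integral_exp_mul_complex_Ioi hare 0, hfac]
  field_simp
  simp

/-- The ray integral of `e^{iλx} F̃[φ](λ)`, with the order of integration exchanged. -/
theorem integral_ray_Ftilde {φ : ℝ → ℂ} (hφ : SchwartzHalfLine φ) {x : ℝ} (hx : 0 < x) {w : ℂ}
    (hw : 0 < w.im) (h₁ : (alpha * w).im ≤ 0) (h₂ : (alpha ^ 2 * w).im ≤ 0) :
    ∫ t in Ioi (0 : ℝ), Complex.exp (Complex.I * (t * w) * x) * Ftilde φ (t * w) * w
      = ∫ y in Ioi (0 : ℝ), φ y * (alpha ^ 2 * (Complex.I / (x - alpha * y))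
          + alpha * (Complex.I / (x - alpha ^ 2 * y))) := by
  have hcont := hφ.1.continuous
  have hint : Integrable (Function.uncurry fun t y : ℝ => Complex.exp (Complex.I * (t * w) * x)
      * (φ y * (alpha ^ 2 * Complex.exp (-Complex.I * alpha * (t * w) * (y : ℂ))
        + alpha * Complex.exp (-Complex.I * alpha ^ 2 * (t * w) * (y : ℂ)))) * w)
      ((volume.restrict (Ioi (0 : ℝ))).prod (volume.restrict (Ioi (0 : ℝ)))) := by
    have hexp : IntegrableOn (fun t : ℝ => Real.exp (-(w.im * x) * t)) (Ioi 0) :=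
      integrableOn_exp_mul_Ioi (by nlinarith [mul_pos hw hx]) 0
    refine Integrable.mono' ((hexp.mul_prod hφ.integrableOn.norm).mul_const (2 * ‖w‖)) ?_ ?_
    · refine Continuous.aestronglyMeasurable ?_
      simp only [Function.uncurry_def]
      fun_prop
    · rw [Measure.prod_restrict]
      filter_upwards [ae_restrict_mem (measurableSet_Ioi.prod measurableSet_Ioi)] with ⟨t, y⟩ hty
      have ht : 0 < t := hty.1
      have hy : 0 < y := hty.2
      have him : ∀ c : ℂ, (c * w).im ≤ 0 → (c * (t * w)).im ≤ 0 := fun c hc => by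
        rw [mul_left_comm, Complex.im_ofReal_mul]
        exact mul_nonpos_of_nonneg_of_nonpos ht.le hc
      have b₁ := norm_cexp_neg_I_mul_le_one (him _ h₁) hy.le
      have b₂ := norm_cexp_neg_I_mul_le_one (him _ h₂) hy.le
      have b₀ : ‖Complex.exp (Complex.I * (t * w) * x)‖ = Real.exp (-(w.im * x) * t) := by
        rw [Complex.norm_exp, Complex.re_mul_ofReal, Complex.I_mul_re, Complex.im_ofReal_mul]
        ring_nf
      have b : ‖alpha ^ 2 * Complex.exp (-Complex.I * alpha * (t * w) * (y : ℂ))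
          + alpha * Complex.exp (-Complex.I * alpha ^ 2 * (t * w) * (y : ℂ))‖ ≤ 2 := by
        refine (norm_add_le _ _).trans ?_
        rw [norm_mul, norm_mul, norm_pow, norm_alpha]
        linarith
      simp only [Function.uncurry_apply_pair, norm_mul, b₀]
      calc _ ≤ Real.exp (-(w.im * x) * t) * (‖φ y‖ * 2) * ‖w‖ := by gcongr
        _ = _ := by ring
  calc _ = ∫ t in Ioi (0 : ℝ), ∫ y in Ioi (0 : ℝ), Complex.exp (Complex.I * (t * w) * x)
      * (φ y * (alpha ^ 2 * Complex.exp (-Complex.I * alpha * (t * w) * (y : ℂ))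
        + alpha * Complex.exp (-Complex.I * alpha ^ 2 * (t * w) * (y : ℂ)))) * w := by
        simp only [Ftilde, integral_mul_const, integral_const_mul]
    _ = _ := by
      rw [integral_integral_swap hint]
      refine setIntegral_congr_fun measurableSet_Ioi fun y hy => ?_
      obtain ⟨i₁, e₁⟩ := integral_ray_cexp hx (le_of_lt hy) hw h₁
      obtain ⟨i₂, e₂⟩ := integral_ray_cexp hx (le_of_lt hy) hw h₂
      rw [← e₁, ← e₂, ← integral_const_mul, ← integral_const_mul,
        ← integral_add ((i₁.mul_const w).const_mul _) ((i₂.mul_const w).const_mul _),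
        ← integral_const_mul]
      congr 1 with t
      ring

theorem rayIntegral_cexp_mul_Ftilde {φ : ℝ → ℂ} (hφ : SchwartzHalfLine φ) {x : ℝ} (hx : 0 < x)
    {θ : ℝ} (h₁ : Real.pi / 3 ≤ θ) (h₂ : θ ≤ 2 * Real.pi / 3) :
    rayIntegral θ (fun l => Complex.exp (Complex.I * l * (x : ℂ)) * Ftilde φ l)
      = ∫ y in Ioi (0 : ℝ), φ y * (alpha ^ 2 * (Complex.I / (x - alpha * y))
          + alpha * (Complex.I / (x - alpha ^ 2 * y))) := by
  have hπ := Real.pi_pos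
  have hsin : ∀ ψ : ℝ, Real.pi ≤ ψ → ψ ≤ 2 * Real.pi → Real.sin ψ ≤ 0 := fun ψ ha hb => by
    rw [← Real.sin_sub_two_pi]
    exact Real.sin_nonpos_of_nonpos_of_neg_pi_le (by linarith) (by linarith)
  refine integral_ray_Ftilde hφ hx ?_ ?_ ?_
  · rw [Complex.exp_ofReal_mul_I_im]
    exact Real.sin_pos_of_pos_of_lt_pi (by linarith) (by linarith)
  · have e : alpha * Complex.exp (θ * Complex.I)
        = Complex.exp ((2 * Real.pi / 3 + θ : ℝ) * Complex.I) := by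
      rw [alpha, ← Complex.exp_add]
      push_cast
      ring_nf
    rw [e, Complex.exp_ofReal_mul_I_im]
    exact hsin _ (by linarith) (by linarith)
  · have e : alpha ^ 2 * Complex.exp (θ * Complex.I)
        = Complex.exp ((4 * Real.pi / 3 + θ : ℝ) * Complex.I) := by
      rw [alpha, ← Complex.exp_nat_mul, ← Complex.exp_add]
      push_cast
      ring_nf
    rw [e, Complex.exp_ofReal_mul_I_im]
    exact hsin _ (by linarith) (by linarith)

/-- for `φ ∈ 𝒮[0,∞)` and every `x > 0`,
`∫_{∂D⁺} e^{iλx} F̃[φ](λ) dλ = 0`. -/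
theorem stmt2 (φ : ℝ → ℂ) (hφ : SchwartzHalfLine φ) :
    ∀ x : ℝ, 0 < x →
      bdDplus (fun l => Complex.exp (Complex.I * l * (x : ℂ)) * Ftilde φ l) = 0 := by
  intro x hx
  have hπ := Real.pi_pos
  rw [bdDplus, rayIntegral_cexp_mul_Ftilde hφ hx le_rfl (by linarith),
    rayIntegral_cexp_mul_Ftilde hφ hx (by linarith) le_rfl, sub_self]
end
end

section
/- Let T > 0 and let q : [0,∞)×[0,T] → ℂ be sufficiently smooth with q(·,s) ∈ 𝒮[0,∞) and q(0,s) = 0 for all s ∈ [0,T]. Set ω(λ) = iλ/(1+λ²), ω_M(λ) = 1+λ² on ℝ and 1+λ^{−2} on 𝒞, R_L = 0, and R_M[q_t](λ;s) = q_{xt}(0,s) on ℝ and −q_{xt}(0,s)/λ² on 𝒞. Then for all t ∈ [0,T] and all x ∈ (0,∞), F⁻¹[∫₀^t e^{ω(λ)(s−t)} (R_L[q](λ;s) + R_M[q_t](λ;s))/ω_M(λ) ds](x) = 0; equivalently, (1/2π)∫_ℝ e^{iλx}(1+λ²)^{−1}∫₀^t e^{ω(λ)(s−t)} q_{xt}(0,s)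 ds dλ = (1/2π)∫_𝒞 e^{iλx}(1+λ²)^{−1}∫₀^t e^{ω(λ)(s−t)} q_{xt}(0,s) ds dλ. -/
open MeasureTheory Set

noncomputable section

/-- `q_{xt}(0,s)`, the mixed derivative of `q` at `x = 0`. -/
def qxt (q : ℝ → ℝ → ℂ) (s : ℝ) : ℂ := deriv (fun s' => deriv (fun x => q x s') 0) s

section HalfPlane

open Filter Topology Complex

/-- A function on the line dominated by `C / |l + i|²` is integrable. -/
lemma integrable_of_norm_mul_norm_add_I_sq_le {f : ℝ → ℂ} (hf : Continuous f) {C : ℝ}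
    (hC : ∀ l : ℝ, ‖f l‖ * ‖(l : ℂ) + I‖ ^ 2 ≤ C) : Integrable f := by
  refine (integrable_inv_one_add_sq.const_mul C).mono' hf.aestronglyMeasurable
    (Eventually.of_forall fun l => ?_)
  have h := hC l
  have h2 : ‖(l : ℂ) + I‖ ^ 2 = 1 + l ^ 2 := by
    rw [Complex.sq_norm, Complex.normSq_apply]; simp; ring
  rw [h2] at h
  rw [← div_eq_mul_inv, le_div_iff₀ (by positivity)]
  exact h

/-- Cauchy's theorem in the upper half-plane for functions of decay `O(|z|⁻²)`. -/
lemma integral_real_eq_zero_of_upperHalfPlane_decay {g : ℂ → ℂ}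
    (hg : DifferentiableOn ℂ g {z | -1 < z.im}) {C : ℝ}
    (hC : ∀ z : ℂ, 0 ≤ z.im → ‖g z‖ * ‖z + I‖ ^ 2 ≤ C) :
    Integrable (fun l : ℝ => g l) ∧ ∫ l : ℝ, g l = 0 := by
  have hcont : Continuous fun l : ℝ => g l :=
    hg.continuousOn.comp_continuous Complex.continuous_ofReal (by simp)
  have hint : Integrable fun l : ℝ => g l :=
    integrable_of_norm_mul_norm_add_I_sq_le hcont fun l => hC l (by simp)
  refine ⟨hint, ?_⟩
  have hlim := intervalIntegral_tendsto_integral hint tendsto_neg_atTop_atBot tendsto_id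
  refine tendsto_nhds_unique hlim (squeeze_zero_norm' ?_
    (tendsto_const_nhds.div_atTop tendsto_id : Tendsto (fun R : ℝ => (4 * C) / R) atTop (𝓝 0)))
  filter_upwards [eventually_gt_atTop 0] with R hR
  have hrect := Complex.integral_boundary_rect_eq_zero_of_differentiableOn g (-R : ℝ)
    (R + R * I) (hg.mono fun z hz => by
      have := hz.2
      simp [uIcc_of_le hR.le] at this
      exact lt_of_lt_of_le (by norm_num) this.1)
  have hb : ∀ z : ℂ, 0 ≤ z.im → (R ≤ |z.re| ∨ R ≤ z.im) → ‖g z‖ ≤ C / R ^ 2 := by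
    intro z hz h
    have hRz : R ≤ ‖z + I‖ := by
      rcases h with h | h
      · exact h.trans (by simpa using Complex.abs_re_le_norm (z + I))
      · refine le_trans ?_ (Complex.abs_im_le_norm (z + I))
        rw [abs_of_nonneg (by simp; linarith)]
        simp; linarith
    rw [le_div_iff₀ (by positivity)]
    refine le_trans ?_ (hC z hz)
    gcongr
  simp only [id]
  have e1 : ‖∫ x : ℝ in -R..R, g (x + R * I)‖ ≤ C / R ^ 2 * |R - -R| :=
    intervalIntegral.norm_integral_le_of_norm_le_const fun x _ =>
      hb _ (by simpa using hR.le) (Or.inr (by simp))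
  have e2 : ‖∫ y : ℝ in (0 : ℝ)..R, g (R + y * I)‖ ≤ C / R ^ 2 * |R - 0| :=
    intervalIntegral.norm_integral_le_of_norm_le_const fun y hy => by
      rw [uIoc_of_le hR.le] at hy
      exact hb _ (by simpa using hy.1.le) (Or.inl (by simpa using le_abs_self R))
  have e3 : ‖∫ y : ℝ in (0 : ℝ)..R, g (-R + y * I)‖ ≤ C / R ^ 2 * |R - 0| :=
    intervalIntegral.norm_integral_le_of_norm_le_const fun y hy => by
      rw [uIoc_of_le hR.le] at hy
      exact hb _ (by simpa using hy.1.le) (Or.inl (by simpa using le_abs_self R))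
  simp at hrect
  have hsplit : (∫ x : ℝ in -R..R, g x) = (∫ x : ℝ in -R..R, g (x + R * I))
      - I * (∫ y : ℝ in (0 : ℝ)..R, g (R + y * I))
      + I * (∫ y : ℝ in (0 : ℝ)..R, g (-R + y * I)) := by
    linear_combination hrect
  rw [hsplit]
  refine (norm_add_le _ _).trans ?_
  refine (add_le_add_left (norm_sub_le _ _) _).trans ?_
  rw [norm_mul, norm_mul, Complex.norm_I, one_mul, one_mul]
  rw [abs_of_pos (by linarith)] at e1 e2 e3
  have : 4 * C / R = C / R ^ 2 * (R - -R) + C / R ^ 2 * (R - 0) + C / R ^ 2 * (R - 0) := by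
    field_simp; ring
  linarith

/-- Dividing out a zero at `i` improves the decay in the upper half-plane by one order. -/
lemma exists_decay_bound_of_mul_sub_I {g : ℂ → ℂ} (hg : DifferentiableOn ℂ g {z | -1 < z.im})
    {C : ℝ} (k : ℕ) (hC : ∀ z : ℂ, 0 ≤ z.im → ‖g z‖ * ‖z - I‖ * ‖z + I‖ ^ k ≤ C) :
    ∃ C' : ℝ, ∀ z : ℂ, 0 ≤ z.im → ‖g z‖ * ‖z + I‖ ^ (k + 1) ≤ C' := by
  have hsub : Metric.closedBall I (1 / 2) ⊆ {z : ℂ | -1 < z.im} := by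
    intro z hz
    rw [mem_closedBall_iff_norm] at hz
    have h1 := (Complex.abs_im_le_norm (z - I)).trans hz
    simp only [sub_im, I_im, abs_le] at h1
    simp only [mem_ofPred_eq]
    linarith [h1.1]
  have hcont : ContinuousOn (fun z => ‖g z‖ * ‖z + I‖ ^ (k + 1)) (Metric.closedBall I (1 / 2)) :=
    (hg.continuousOn.mono hsub).norm.mul (by fun_prop)
  obtain ⟨M, hM⟩ := (isCompact_closedBall I (1 / 2 : ℝ)).bddAbove_image hcont
  refine ⟨max M (5 * C), fun z hz => ?_⟩
  by_cases hzb : z ∈ Metric.closedBall I (1 / 2)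
  · exact (hM ⟨z, hzb, rfl⟩).trans (le_max_left _ _)
  · rw [mem_closedBall_iff_norm, not_le] at hzb
    refine le_trans ?_ (le_max_right _ _)
    have h2 : ‖z + I‖ ≤ 5 * ‖z - I‖ := by
      have : ‖z + I‖ ≤ ‖z - I‖ + ‖2 * I‖ := by
        have := norm_add_le (z - I) (2 * I)
        rwa [show z - I + 2 * I = z + I by ring] at this
      have h3 : ‖2 * I‖ = 2 := by simp
      linarith
    calc ‖g z‖ * ‖z + I‖ ^ (k + 1) = ‖g z‖ * ‖z + I‖ ^ k * ‖z + I‖ := by ring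
      _ ≤ ‖g z‖ * ‖z + I‖ ^ k * (5 * ‖z - I‖) := by gcongr
      _ = 5 * (‖g z‖ * ‖z - I‖ * ‖z + I‖ ^ k) := by ring
      _ ≤ 5 * C := by linarith [hC z hz]

/-- Residue theorem for the upper half-plane, for a pole of order `n + 1` at `i`. -/
lemma integral_real_eq_circleIntegral_of_pole {r : ℝ} (hr : 0 < r) (hr1 : r < 1) (n : ℕ) :
    ∀ {h : ℂ → ℂ}, DifferentiableOn ℂ h {z | -1 < z.im} →
      (∃ C : ℝ, ∀ z : ℂ, 0 ≤ z.im → ‖h z‖ * ‖z + I‖ ≤ C) →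
      Integrable (fun l : ℝ => (((l : ℂ) - I) ^ (n + 1))⁻¹ * h l) ∧
      ∫ l : ℝ, (((l : ℂ) - I) ^ (n + 1))⁻¹ * h l
        = ∮ z in C(I, r), ((z - I) ^ (n + 1))⁻¹ * h z := by
  have hU : IsOpen {z : ℂ | -1 < z.im} := isOpen_lt continuous_const Complex.continuous_im
  have hIU : {z : ℂ | -1 < z.im} ∈ 𝓝 I := hU.mem_nhds (by simp)
  have hball : Metric.closedBall I r ⊆ {z : ℂ | -1 < z.im} := by
    intro z hz
    rw [mem_closedBall_iff_norm] at hz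
    have h1 := (Complex.abs_im_le_norm (z - I)).trans hz
    simp only [sub_im, I_im, abs_le] at h1
    simp only [mem_ofPred_eq]
    linarith [h1.1]
  have hneR : ∀ l : ℝ, (l : ℂ) - I ≠ 0 := fun l h => by
    simpa using congrArg Complex.im h
  have hneP : ∀ z : ℂ, -1 < z.im → z + I ≠ 0 := fun z hz h => by
    have := congrArg Complex.im h
    simp at this
    linarith
  have hneS : ∀ z ∈ Metric.sphere I r, z - I ≠ 0 := fun z hz h => by
    rw [mem_sphere_iff_norm, h, norm_zero] at hz
    exact hr.ne hz
  have hds : ∀ (f : ℂ → ℂ) (z : ℂ), f z = f I + (z - I) * dslope f I z := fun f z => by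
    have := sub_smul_dslope f I z
    rw [smul_eq_mul] at this
    rw [this]; ring
  induction n with
  | zero =>
    rintro h hh ⟨C, hC⟩
    set k : ℂ → ℂ := fun z => h z - h I * (2 * I) * (z + I)⁻¹ with hk
    have hkd : DifferentiableOn ℂ k {z | -1 < z.im} :=
      hh.sub (DifferentiableOn.const_mul
        ((differentiableOn_id.add_const I).inv fun z hz => hneP z hz) _)
    have hkI : k I = 0 := by
      have : (2 * I : ℂ) ≠ 0 := by simp
      simp only [hk, ← two_mul]
      rw [mul_assoc, mul_inv_cancel₀ this]; ring
    set g := dslope k I with hg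
    have hgd : DifferentiableOn ℂ g {z | -1 < z.im} := (differentiableOn_dslope hIU).2 hkd
    have hkg : ∀ z, k z = (z - I) * g z := fun z => by
      rw [hds k z, hkI, zero_add]
    obtain ⟨C', hC'⟩ := exists_decay_bound_of_mul_sub_I hgd (C := C + 2 * ‖h I‖) 1 fun z hz => by
      rw [pow_one, mul_comm ‖g z‖, ← norm_mul, ← hkg]
      have hzI : ‖z + I‖ ≠ 0 := norm_ne_zero_iff.2 (hneP z (by linarith))
      calc ‖k z‖ * ‖z + I‖ ≤ (‖h z‖ + ‖h I * (2 * I) * (z + I)⁻¹‖) * ‖z + I‖ := by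
            gcongr; exact norm_sub_le _ _
        _ = ‖h z‖ * ‖z + I‖ + 2 * ‖h I‖ := by
            simp only [norm_mul, norm_inv, Complex.norm_I, Complex.norm_ofNat]
            field_simp
        _ ≤ _ := by linarith [hC z hz]
    obtain ⟨hgi, hg0⟩ := integral_real_eq_zero_of_upperHalfPlane_decay hgd hC'
    have hsplit : (fun l : ℝ => (((l : ℂ) - I) ^ (0 + 1))⁻¹ * h l)
        = fun l : ℝ => h I * (2 * I) * (((1 + l ^ 2)⁻¹ : ℝ) : ℂ) + g l := by
      funext l
      have h1 := hneR l
      have h2 := hneP l (by simp)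
      have h3 : (h l : ℂ) = h I * (2 * I) * ((l : ℂ) + I)⁻¹ + (l - I) * g l := by
        rw [← hkg]; simp only [hk]; ring
      have h4 : (1 + (l : ℂ) ^ 2) = (l - I) * (l + I) := by
        linear_combination I_sq
      push_cast
      rw [h3, h4]
      field_simp
    have hmi : Integrable fun l : ℝ => h I * (2 * I) * (((1 + l ^ 2)⁻¹ : ℝ) : ℂ) :=
      (integrable_inv_one_add_sq.ofReal (𝕜 := ℂ)).const_mul _
    rw [hsplit]
    refine ⟨hmi.add hgi, ?_⟩
    rw [integral_add hmi hgi, hg0, integral_const_mul, integral_complex_ofReal,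
      integral_univ_inv_one_add_sq]
    have hcauchy := Complex.circleIntegral_sub_inv_smul_of_differentiable_on_off_countable
      countable_empty (Metric.mem_ball_self hr) (hh.continuousOn.mono hball)
      (fun z hz => hh.differentiableAt
        (hU.mem_nhds (hball (Metric.ball_subset_closedBall hz.1))))
    simp only [smul_eq_mul] at hcauchy
    simp only [zero_add, pow_one]
    rw [hcauchy]
    ring
  | succ n ih =>
    rintro h hh ⟨C, hC⟩
    set g := dslope h I with hg
    have hgd : DifferentiableOn ℂ g {z | -1 < z.im} := (differentiableOn_dslope hIU).2 hh
    obtain ⟨C', hC'⟩ := exists_decay_bound_of_mul_sub_I hgd (C := C + ‖h I‖) 0 fun z hz => by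
      rw [pow_zero, mul_one, mul_comm, ← norm_mul, show (z - I) * g z = h z - h I by
        rw [hds h z]; ring]
      have h1 : 1 ≤ ‖z + I‖ := by
        refine le_trans ?_ (Complex.abs_im_le_norm (z + I))
        rw [add_im, I_im, abs_of_nonneg] <;> linarith
      have h2 : ‖h z‖ ≤ ‖h z‖ * ‖z + I‖ := le_mul_of_one_le_right (norm_nonneg _) h1
      linarith [hC z hz, norm_sub_le (h z) (h I)]
    obtain ⟨hgi, hge⟩ := ih hgd ⟨C', by simpa using hC'⟩
    have hpow : ∀ w : ℂ, w - I ≠ 0 → ((w - I) ^ (n + 1 + 1))⁻¹ * h w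
        = h I * ((w - I) ^ (n + 1 + 1))⁻¹ + ((w - I) ^ (n + 1))⁻¹ * g w := fun w hw => by
      rw [hds h w, hg]
      field_simp
      ring
    obtain ⟨hpi, hp0⟩ := integral_real_eq_zero_of_upperHalfPlane_decay
      (g := fun z => ((z + I) ^ (n + 1 + 1))⁻¹) (C := 1)
      (((differentiableOn_id.add_const I).pow _).inv fun z hz => pow_ne_zero _ (hneP z hz))
      (fun z hz => by
        have h1 : 1 ≤ ‖z + I‖ := by
          refine le_trans ?_ (Complex.abs_im_le_norm (z + I))
          rw [add_im, I_im, abs_of_nonneg] <;> linarith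
        rw [norm_inv, norm_pow, inv_mul_le_iff₀ (by positivity), mul_one]
        exact pow_le_pow_right₀ h1 (by omega))
    have hrefl : (fun l : ℝ => (((l : ℂ) - I) ^ (n + 1 + 1))⁻¹)
        = fun l : ℝ => (-1) ^ (n + 1 + 1) * ((((-l : ℝ) : ℂ) + I) ^ (n + 1 + 1))⁻¹ := by
      funext l
      rw [show ((l : ℂ) - I) = (-1) * (((-l : ℝ) : ℂ) + I) by push_cast; ring, mul_pow, mul_inv,
        ← inv_pow]
      norm_num
    have hqi : Integrable fun l : ℝ => (((l : ℂ) - I) ^ (n + 1 + 1))⁻¹ := by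
      rw [hrefl]; exact hpi.comp_neg.const_mul _
    have hq0 : ∫ l : ℝ, (((l : ℂ) - I) ^ (n + 1 + 1))⁻¹ = 0 := by
      rw [hrefl, integral_const_mul,
        integral_neg_eq_self (fun l : ℝ => (((l : ℂ) + I) ^ (n + 1 + 1))⁻¹), hp0, mul_zero]
    have hfun := funext fun l : ℝ => hpow l (hneR l)
    rw [hfun]
    refine ⟨(hqi.const_mul _).add hgi, ?_⟩
    rw [integral_add (hqi.const_mul _) hgi, integral_const_mul, hq0, hge,
      circleIntegral.integral_congr hr.le fun z hz => hpow z (hneS z hz),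
      circleIntegral.integral_add, circleIntegral.integral_const_mul]
    · have := circleIntegral.integral_sub_zpow_of_ne (n := -((n + 1 + 1 : ℕ) : ℤ)) (by omega) I I r
      simp only [zpow_neg, zpow_natCast] at this
      rw [this]
    · refine ContinuousOn.circleIntegrable hr.le (ContinuousOn.mul continuousOn_const
        (ContinuousOn.inv₀ (by fun_prop) fun z hz => pow_ne_zero _ (hneS z hz)))
    · exact ContinuousOn.circleIntegrable hr.le (ContinuousOn.mul
        (ContinuousOn.inv₀ (by fun_prop) fun z hz => pow_ne_zero _ (hneS z hz))
        (hgd.continuousOn.mono (Metric.sphere_subset_closedBall.trans hball)))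

/-- Termwise integration of a series over a circle. -/
lemma hasSum_circleIntegral_of_norm_le {c : ℂ} {r : ℝ} (hr : 0 ≤ r) {f : ℕ → ℂ → ℂ} {F : ℂ → ℂ}
    {u : ℕ → ℝ} (hu : Summable u) (hf : ∀ n, ContinuousOn (f n) (Metric.sphere c r))
    (hfu : ∀ n, ∀ z ∈ Metric.sphere c r, ‖f n z‖ ≤ u n)
    (hF : ∀ z ∈ Metric.sphere c r, HasSum (fun n => f n z) (F z)) :
    HasSum (fun n => ∮ z in C(c, r), f n z) (∮ z in C(c, r), F z) := by
  have hmem : ∀ θ, circleMap c r θ ∈ Metric.sphere c r := circleMap_mem_sphere c hr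
  refine intervalIntegral.hasSum_integral_of_dominated_convergence (fun n _ => r * u n)
    (fun n => ?_) (fun n => ?_) ?_ ?_ ?_
  · refine Continuous.aestronglyMeasurable ?_
    simp only [deriv_circleMap]
    exact ((continuous_circleMap 0 r).mul continuous_const).smul
      ((hf n).comp_continuous (continuous_circleMap c r) hmem)
  · refine Eventually.of_forall fun θ _ => ?_
    rw [norm_smul, deriv_circleMap, norm_mul, Complex.norm_I, mul_one, norm_circleMap_zero,
      abs_of_nonneg hr]
    exact mul_le_mul_of_nonneg_left (hfu n _ (hmem θ)) hr
  · exact Eventually.of_forall fun θ _ => hu.mul_left r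
  · exact intervalIntegrable_const
  · exact Eventually.of_forall fun θ _ => (hF _ (hmem θ)).const_smul _

/-- The power series of the entire function `z ↦ ∫₀ᵗ e^{z(s-t)} f(s) ds`. -/
lemma hasSum_integral_exp_mul {f : ℝ → ℂ} (hf : Continuous f) (t : ℝ) (z : ℂ) :
    HasSum (fun n : ℕ => z ^ n * ∫ s in (0 : ℝ)..t, ((s : ℂ) - t) ^ n / (n.factorial : ℂ) * f s)
      (∫ s in (0 : ℝ)..t, Complex.exp (z * ((s : ℂ) - t)) * f s) := by
  have hexp : ∀ w : ℂ, HasSum (fun n : ℕ => w ^ n / (n.factorial : ℂ)) (Complex.exp w) := fun w => by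
    rw [Complex.exp_eq_exp_ℂ]
    exact NormedSpace.expSeries_div_hasSum_exp w
  have hexpR : ∀ w : ℝ, HasSum (fun n : ℕ => w ^ n / (n.factorial : ℝ)) (Real.exp w) := fun w => by
    rw [Real.exp_eq_exp_ℝ]
    exact NormedSpace.expSeries_div_hasSum_exp w
  simp only [← intervalIntegral.integral_const_mul]
  have hb : ∀ s : ℝ, HasSum (fun n : ℕ => (‖z‖ * ‖(s : ℂ) - t‖) ^ n / (n.factorial : ℝ) * ‖f s‖)
      (Real.exp (‖z‖ * ‖(s : ℂ) - t‖) * ‖f s‖) := fun s => (hexpR _).mul_right _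
  refine intervalIntegral.hasSum_integral_of_dominated_convergence
    (fun n s => (‖z‖ * ‖(s : ℂ) - t‖) ^ n / (n.factorial : ℝ) * ‖f s‖)
    (fun n => ?_) (fun n => ?_) ?_ ?_ ?_
  · exact Continuous.aestronglyMeasurable (by fun_prop)
  · refine Eventually.of_forall fun s _ => le_of_eq ?_
    simp only [norm_mul, norm_div, norm_pow, mul_pow, Complex.norm_natCast]
    ring
  · exact Eventually.of_forall fun s _ => (hb s).summable
  · simp only [fun s => (hb s).tsum_eq]
    exact Continuous.intervalIntegrable (by fun_prop) _ _
  · refine Eventually.of_forall fun s _ => ?_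
    refine ((hexp (z * ((s : ℂ) - t))).mul_right (f s)).congr_fun ?_
    intro n
    rw [mul_pow]; ring

/-- Deformation of the real line to a circle around `i`, for functions with the essential
singularity of an entire function of `iz / (1 + z²)`. -/
lemma integral_real_eq_circleIntegral_of_hasSum {r : ℝ} (hr : 0 < r) (hr1 : r < 1) {x : ℝ}
    (hx : 0 ≤ x) {a : ℕ → ℂ} {Φ : ℂ → ℂ} (hΦ : ∀ z, HasSum (fun n => z ^ n * a n) (Φ z)) :
    ∫ l : ℝ, Complex.exp (I * l * x) * ((1 + (l : ℂ) ^ 2)⁻¹ * Φ (I * l / (1 + (l : ℂ) ^ 2)))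
      = ∮ z in C(I, r), Complex.exp (I * z * x) * ((1 + z ^ 2)⁻¹ * Φ (I * z / (1 + z ^ 2))) := by
  have hneR : ∀ l : ℝ, (l : ℂ) - I ≠ 0 := fun l h => by
    simpa using congrArg Complex.im h
  have hneP : ∀ z : ℂ, -1 < z.im → z + I ≠ 0 := fun z hz h => by
    have := congrArg Complex.im h
    simp at this
    linarith
  have hneS : ∀ z ∈ Metric.sphere I r, z - I ≠ 0 := fun z hz h => by
    rw [mem_sphere_iff_norm, h, norm_zero] at hz
    exact hr.ne hz
  have hSU : ∀ z ∈ Metric.sphere I r, -1 < z.im := fun z hz => by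
    rw [mem_sphere_iff_norm] at hz
    have h1 := (Complex.abs_im_le_norm (z - I)).trans hz.le
    simp only [sub_im, I_im, abs_le] at h1
    linarith [h1.1]
  have hfac : ∀ z : ℂ, 1 + z ^ 2 = (z - I) * (z + I) := fun z => by
    linear_combination I_sq
  set h : ℕ → ℂ → ℂ := fun n z => Complex.exp (I * z * x) * (I * z) ^ n * ((z + I) ^ (n + 1))⁻¹
    with hh
  set P : ℕ → ℂ → ℂ := fun n z => a n * (((z - I) ^ (n + 1))⁻¹ * h n z) with hP
  have hPeq : ∀ n z, P n z
      = Complex.exp (I * z * x) * ((1 + z ^ 2)⁻¹ * ((I * z / (1 + z ^ 2)) ^ n * a n)) := by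
    intro n z
    simp only [hP, hh]
    rw [hfac, div_eq_mul_inv, mul_inv]
    simp only [mul_pow, pow_succ, mul_inv, inv_pow]
    ring
  have hPsum : ∀ z, HasSum (fun n => P n z)
      (Complex.exp (I * z * x) * ((1 + z ^ 2)⁻¹ * Φ (I * z / (1 + z ^ 2)))) := fun z => by
    simp only [hPeq]
    exact ((hΦ _).mul_left _).mul_left _
  have hEle : ∀ z : ℂ, 0 ≤ z.im → ‖Complex.exp (I * z * x)‖ ≤ 1 := fun z hz => by
    rw [Complex.norm_exp, Real.exp_le_one_iff]
    simp
    positivity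
  have hres : ∀ n, ∫ l : ℝ, P n l = ∮ z in C(I, r), P n z := by
    intro n
    simp only [hP]
    rw [integral_const_mul, circleIntegral.integral_const_mul,
      (integral_real_eq_circleIntegral_of_pole hr hr1 n (h := h n) ?_ ⟨1, fun z hz => ?_⟩).2]
    · refine DifferentiableOn.mul (by fun_prop) (DifferentiableOn.inv (by fun_prop) fun z hz =>
        pow_ne_zero _ (hneP z hz))
    · have hz0 : 0 < ‖z + I‖ := norm_pos_iff.2 (hneP z (by linarith))
      have hzle : ‖z‖ ≤ ‖z + I‖ := by
        rw [← sq_le_sq₀ (norm_nonneg _) (norm_nonneg _), Complex.sq_norm, Complex.sq_norm,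
          Complex.normSq_apply, Complex.normSq_apply]
        simp only [add_re, I_re, add_im, I_im]
        nlinarith
      simp only [hh, norm_mul, norm_pow, norm_inv, Complex.norm_I, one_mul]
      calc ‖Complex.exp (I * z * x)‖ * ‖z‖ ^ n * (‖z + I‖ ^ (n + 1))⁻¹ * ‖z + I‖
          ≤ 1 * ‖z + I‖ ^ n * (‖z + I‖ ^ (n + 1))⁻¹ * ‖z + I‖ := by
            gcongr
            exact hEle z hz
        _ = 1 := by rw [pow_succ]; field_simp
  have hnorm : ∀ K : ℝ, Summable fun n => K ^ n * ‖a n‖ := fun K => by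
    have := (hΦ (|K| : ℝ)).summable.norm
    refine Summable.of_norm ?_
    simpa using this
  have hline : HasSum (fun n => ∫ l : ℝ, P n l) (∫ l : ℝ, Complex.exp (I * l * x)
      * ((1 + (l : ℂ) ^ 2)⁻¹ * Φ (I * l / (1 + (l : ℂ) ^ 2)))) := by
    have hs : Summable fun n => ‖a n‖ := by simpa using hnorm 1
    have hone : ∀ l : ℝ, ‖1 + (l : ℂ) ^ 2‖ = 1 + l ^ 2 := fun l => by
      rw [show 1 + (l : ℂ) ^ 2 = ((1 + l ^ 2 : ℝ) : ℂ) by push_cast; ring, Complex.norm_real,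
        Real.norm_of_nonneg (by positivity)]
    refine hasSum_integral_of_dominated_convergence (fun n l => ‖a n‖ * (1 + l ^ 2)⁻¹)
      (fun n => ?_) (fun n => Eventually.of_forall fun l => ?_) ?_ ?_
      (Eventually.of_forall fun l => hPsum l)
    · refine Continuous.aestronglyMeasurable ?_
      simp only [hP, hh]
      refine continuous_const.mul (Continuous.mul (Continuous.inv₀ (by fun_prop)
        fun l => pow_ne_zero _ (hneR l)) (Continuous.mul (by fun_prop) (Continuous.inv₀
        (by fun_prop) fun l => pow_ne_zero _ (hneP l (by simp)))))
    · simp only [hPeq, norm_mul, norm_inv, norm_pow, norm_div, hone, Complex.norm_I, one_mul,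
        Complex.norm_real]
      have h1 : ‖l‖ / (1 + l ^ 2) ≤ 1 := by
        rw [div_le_one (by positivity), ← sq_abs, Real.norm_eq_abs]
        nlinarith [sq_nonneg (|l| - 1)]
      calc ‖Complex.exp (I * l * x)‖ * ((1 + l ^ 2)⁻¹ * ((‖l‖ / (1 + l ^ 2)) ^ n * ‖a n‖))
          ≤ 1 * ((1 + l ^ 2)⁻¹ * (1 ^ n * ‖a n‖)) := by
            gcongr
            exact hEle l (by simp)
        _ = _ := by ring
    · exact Eventually.of_forall fun l => hs.mul_right _
    · simp only [tsum_mul_right]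
      exact integrable_inv_one_add_sq.const_mul _
  have hcircle : HasSum (fun n => ∮ z in C(I, r), P n z) (∮ z in C(I, r), Complex.exp (I * z * x)
      * ((1 + z ^ 2)⁻¹ * Φ (I * z / (1 + z ^ 2)))) := by
    have hne : ∀ z ∈ Metric.sphere I r, 1 + z ^ 2 ≠ 0 := fun z hz => by
      rw [hfac]
      exact mul_ne_zero (hneS z hz) (hneP z (hSU z hz))
    have hEc : ContinuousOn (fun z : ℂ => Complex.exp (I * z * x) * (1 + z ^ 2)⁻¹)
        (Metric.sphere I r) :=
      ContinuousOn.mul (by fun_prop) (ContinuousOn.inv₀ (by fun_prop) hne)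
    have hwc : ContinuousOn (fun z : ℂ => I * z / (1 + z ^ 2)) (Metric.sphere I r) :=
      ContinuousOn.div (by fun_prop) (by fun_prop) hne
    obtain ⟨M, hM⟩ := (isCompact_sphere I r).exists_bound_of_continuousOn hEc
    obtain ⟨K, hK⟩ := (isCompact_sphere I r).exists_bound_of_continuousOn hwc
    have hPeq' : ∀ n z, P n z = Complex.exp (I * z * x) * (1 + z ^ 2)⁻¹
        * ((I * z / (1 + z ^ 2)) ^ n * a n) := fun n z => by rw [hPeq]; ring
    refine hasSum_circleIntegral_of_norm_le hr.le ((hnorm K).mul_left M) (fun n => ?_)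
      (fun n z hz => ?_) fun z _ => hPsum z
    · simp only [funext (hPeq' n)]
      exact hEc.mul ((hwc.pow n).mul continuousOn_const)
    · rw [hPeq', norm_mul, norm_mul (_ ^ n), norm_pow]
      have hM0 := (norm_nonneg _).trans (hM z hz)
      gcongr
      exacts [hM z hz, hK z hz]
  simp only [hres] at hline
  exact hline.unique hcircle

end HalfPlane

lemma continuous_qxt {q : ℝ → ℝ → ℂ}
    (hq : ContDiff ℝ (⊤ : ℕ∞) (fun p : ℝ × ℝ => q p.1 p.2)) : Continuous (qxt q) := by
  have hx : ∀ s, deriv (fun x => q x s) 0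
      = fderiv ℝ (fun p : ℝ × ℝ => q p.1 p.2) (0, s) (1, 0) := fun s => by
    have h1 : HasFDerivAt (fun p : ℝ × ℝ => q p.1 p.2)
        (fderiv ℝ (fun p : ℝ × ℝ => q p.1 p.2) (0, s)) (0, s) :=
      (hq.differentiable (by simp) _).hasFDerivAt
    have h2 : HasDerivAt (fun x : ℝ => (x, s)) ((1 : ℝ), (0 : ℝ)) 0 :=
      (hasDerivAt_id 0).prodMk (hasDerivAt_const 0 s)
    exact (h1.comp_hasDerivAt (0 : ℝ) h2).deriv
  have hs : ContDiff ℝ 1 fun s => deriv (fun x => q x s) 0 := by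
    simp only [hx]
    have h3 : ContDiff ℝ 1 (fderiv ℝ (fun p : ℝ × ℝ => q p.1 p.2)) :=
      (contDiff_infty.1 hq 2).fderiv_right (by norm_num)
    exact (h3.comp (contDiff_const.prodMk contDiff_id)).clm_apply contDiff_const
  exact hs.continuous_deriv le_rfl

/-- let `0 < T` and let `q` be sufficiently smooth with `q(·,s) ∈ 𝒮[0,∞)` and
`q(0,s) = 0` for all `s ∈ [0,T]`.  With `ω(λ) = iλ/(1+λ²)`, `ω_M = 1+λ²` on `ℝ` and
`1+λ⁻²` on `𝒞`, `R_L = 0`, and `R_M[q_t](λ;s) = q_{xt}(0,s)` on `ℝ` and `−q_{xt}(0,s)/λ²`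
on `𝒞`, for all `t ∈ [0,T]` and `x ∈ (0,∞)`,
`F⁻¹[∫₀^t e^{ω(λ)(s−t)} (R_L[q](λ;s) + R_M[q_t](λ;s))/ω_M(λ) ds](x) = 0`, i.e.
`(1/2π) ∫_ℝ e^{iλx} ∫₀^t e^{ω(λ)(s−t)} q_{xt}(0,s)/(1+λ²) ds dλ
  + (1/2π) ∫_𝒞 e^{iλx} ∫₀^t e^{ω(λ)(s−t)} (−q_{xt}(0,s)/λ²)/(1+λ⁻²) ds dλ = 0`,
where `𝒞` is the positively oriented circle centred at `i` with radius `r ∈ (0,1)`. -/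
theorem stmt19 (r : ℝ) (hr : 0 < r) (hr1 : r < 1)
    (T : ℝ) (hT : 0 < T) (q : ℝ → ℝ → ℂ)
    (hsmooth : ContDiff ℝ (⊤ : ℕ∞) (fun p : ℝ × ℝ => q p.1 p.2))
    (hSchwartz : ∀ s ∈ Icc (0 : ℝ) T, SchwartzHalfLine (fun x => q x s))
    (hBC : ∀ s ∈ Icc (0 : ℝ) T, q 0 s = 0) :
    ∀ t ∈ Icc (0 : ℝ) T, ∀ x : ℝ, 0 < x →
      (1 / (2 * (Real.pi : ℂ))) * (∫ l : ℝ, Complex.exp (Complex.I * (l : ℂ) * (x : ℂ))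
          * ∫ s in (0 : ℝ)..t,
              Complex.exp ((Complex.I * (l : ℂ) / (1 + (l : ℂ) ^ 2)) * ((s : ℂ) - (t : ℂ)))
                * (qxt q s / (1 + (l : ℂ) ^ 2)))
        + (1 / (2 * (Real.pi : ℂ)))
          * (∮ l in C(Complex.I, r), Complex.exp (Complex.I * l * (x : ℂ))
            * ∫ s in (0 : ℝ)..t,
                Complex.exp ((Complex.I * l / (1 + l ^ 2)) * ((s : ℂ) - (t : ℂ)))
                  * ((-(qxt q s) / l ^ 2) / (1 + 1 / l ^ 2)))
        = 0 := by
  intro t _ x hx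
  have hdef := integral_real_eq_circleIntegral_of_hasSum hr hr1 hx.le
    (hasSum_integral_exp_mul (continuous_qxt hsmooth) t)
  have hline : ∀ l : ℝ, (∫ s in (0 : ℝ)..t,
      Complex.exp ((Complex.I * (l : ℂ) / (1 + (l : ℂ) ^ 2)) * ((s : ℂ) - (t : ℂ)))
        * (qxt q s / (1 + (l : ℂ) ^ 2)))
      = (1 + (l : ℂ) ^ 2)⁻¹ * ∫ s in (0 : ℝ)..t,
        Complex.exp ((Complex.I * (l : ℂ) / (1 + (l : ℂ) ^ 2)) * ((s : ℂ) - (t : ℂ)))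
          * qxt q s := fun l => by
    rw [← intervalIntegral.integral_const_mul]
    congr 1
    funext s
    ring
  have hcircle : EqOn (fun l : ℂ => Complex.exp (Complex.I * l * (x : ℂ))
      * ∫ s in (0 : ℝ)..t, Complex.exp ((Complex.I * l / (1 + l ^ 2)) * ((s : ℂ) - (t : ℂ)))
        * ((-(qxt q s) / l ^ 2) / (1 + 1 / l ^ 2)))
      (fun l : ℂ => (-1) * (Complex.exp (Complex.I * l * (x : ℂ)) * ((1 + l ^ 2)⁻¹
        * ∫ s in (0 : ℝ)..t, Complex.exp ((Complex.I * l / (1 + l ^ 2)) * ((s : ℂ) - (t : ℂ)))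
          * qxt q s))) (Metric.sphere Complex.I r) := fun l hl => by
    have hl0 : l ≠ 0 := by
      rintro rfl
      rw [mem_sphere_iff_norm] at hl
      simp at hl
      linarith
    have hint : (∫ s in (0 : ℝ)..t,
        Complex.exp ((Complex.I * l / (1 + l ^ 2)) * ((s : ℂ) - (t : ℂ)))
          * ((-(qxt q s) / l ^ 2) / (1 + 1 / l ^ 2)))
        = -(1 + l ^ 2)⁻¹ * ∫ s in (0 : ℝ)..t,
          Complex.exp ((Complex.I * l / (1 + l ^ 2)) * ((s : ℂ) - (t : ℂ))) * qxt q s := by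
      rw [← intervalIntegral.integral_const_mul]
      congr 1
      funext s
      have hden : l ^ 2 * (1 + 1 / l ^ 2) = 1 + l ^ 2 := by
        field_simp
        ring
      rw [div_div, hden]
      ring
    simp only [hint]
    ring
  rw [circleIntegral.integral_congr hr.le hcircle, circleIntegral.integral_const_mul, ← hdef]
  simp only [hline]
  ring
end
end
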